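/- Let $T = \langle X_n, Q, \pi, \lambda \rangle$ be a minimal, synchronous, synchronizing invertible transducer with inverse $S = \langle X_n, Q^{-1}, \pi', \lambda' \rangle$, and let $q_0 \in Q$. Then $V_n^{T_{q_0}^{-1}} = V_n(\mathcal{G}(TS))$, where $V_n^{T_{q_0}^{-1}} = T_{q_0} V_n T_{q_0}^{-1}$. -/

import Mathlib

open Classical

noncomputable section

/-- `n`-ary Cantor space: infinite words over the alphabet `Fin n`. -/
abbrev Cantor (n : ℕ) : Type := ℕ → Fin n

/-- The finite word `w` is a prefix of the infinite word `χ`. -/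
def PrefixOf {n : ℕ} (w : List (Fin n)) (χ : Cantor n) : Prop :=
  ∀ (i : ℕ) (h : i < w.length), w.get ⟨i, h⟩ = χ i

/-- Concatenation of a finite word with an infinite word. -/
def appendInf {n : ℕ} (w : List (Fin n)) (χ : Cantor n) : Cantor n :=
  fun i => if h : i < w.length then w.get ⟨i, h⟩ else χ (i - w.length)

/-- The cone (basic clopen set) of infinite words having the finite word `w` as prefix. -/
def cone {n : ℕ} (w : List (Fin n)) : Set (Cantor n) :=
  {χ | PrefixOf w χ}

/-- The length-`k` prefix of an infinite word, as a finite word. -/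
def takeW {n : ℕ} (χ : Cantor n) (k : ℕ) : List (Fin n) :=
  List.ofFn (fun i : Fin k => χ i)

/-- A finite family of finite words forming a maximal antichain:
every infinite word has exactly one member of the family as a prefix. -/
def AntichainFam {n m : ℕ} (α : Fin m → List (Fin n)) : Prop :=
  ∀ χ : Cantor n, ∃! i : Fin m, PrefixOf (α i) χ

/-- The group structure on self-homeomorphisms of a topological space,
with `f * g` acting as `g` followed by `f`. -/
instance homeoGroup {X : Type*} [TopologicalSpace X] : Group (X ≃ₜ X) where
  mul f g := g.trans f
  one := Homeomorph.refl X
  inv := Homeomorph.symm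
  mul_assoc a b c := Homeomorph.ext fun _ => rfl
  one_mul a := Homeomorph.ext fun _ => rfl
  mul_one a := Homeomorph.ext fun _ => rfl
  inv_mul_cancel a := Homeomorph.ext fun x => a.symm_apply_apply x

/-- The Higman–Thompson group `Vₙ`, as the set of self-homeomorphisms of Cantor space
which act by exchanging finite prefixes along a pair of maximal antichains. -/
def Vn (n : ℕ) : Set (Cantor n ≃ₜ Cantor n) :=
  {g | ∃ (m : ℕ) (α β : Fin m → List (Fin n)), AntichainFam α ∧ AntichainFam β ∧
      ∀ (i : Fin m) (χ : Cantor n), g (appendInf (α i) χ) = appendInf (β i) χ}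

/-- Conjugation in the paper's right-action convention: `paperConj g v = g⁻¹ v g`,
i.e. the homeomorphism `x ↦ (x) g⁻¹ v g` (first apply `g⁻¹`, then `v`, then `g`). -/
def paperConj {n : ℕ} (g v : Cantor n ≃ₜ Cantor n) : Cantor n ≃ₜ Cantor n :=
  (g.symm.trans v).trans g

/-- `l` is the longest common prefix of the set `A` of infinite words. -/
def IsLCP {n : ℕ} (A : Set (Cantor n)) (l : List (Fin n)) : Prop :=
  (∀ ρ ∈ A, PrefixOf l ρ) ∧
    ∀ l' : List (Fin n), (∀ ρ ∈ A, PrefixOf l' ρ) → l'.length ≤ l.length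

/-- A (not necessarily finite-state) transducer over the alphabet `Fin n`. -/
structure Transducer (n : ℕ) where
  /-- the set of states -/
  Q : Type
  /-- the transition function -/
  tr : Fin n → Q → Q
  /-- the output (rewrite) function -/
  out : Fin n → Q → List (Fin n)

namespace Transducer

variable {n : ℕ}

/-- The transition function extended to finite words. -/
def transStar (T : Transducer n) : List (Fin n) → T.Q → T.Q
  | [], q => q
  | x :: w, q => T.transStar w (T.tr x q)

/-- The output function extended to finite words. -/
def outStar (T : Transducer n) : List (Fin n) → T.Q → List (Fin n)
  | [], _ => []
  | x :: w, q => T.out x q ++ T.outStar w (T.tr x q)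

/-- The initial transducer `T_q` induces the map `f` on Cantor space: the outputs along
ever longer prefixes of `χ` are ever longer prefixes of `f χ`. -/
def Induces (T : Transducer n) (q : T.Q) (f : Cantor n → Cantor n) : Prop :=
  ∀ (χ : Cantor n) (m : ℕ), ∃ k : ℕ,
    m ≤ (T.outStar (takeW χ k) q).length ∧ PrefixOf (T.outStar (takeW χ k) q) (f χ)

/-- The image of the state `q`: the image of Cantor space under the map induced by `T_q`. -/
def stateImage (T : Transducer n) (q : T.Q) : Set (Cantor n) :=
  {y | ∃ (f : Cantor n → Cantor n) (χ : Cantor n), T.Induces q f ∧ f χ = y}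

/-- `T` is synchronizing at level `k`: the state reached after reading any word of
length `k` does not depend on the starting state. -/
def SyncAtLevel (T : Transducer n) (k : ℕ) : Prop :=
  ∀ w : List (Fin n), w.length = k → ∀ q q' : T.Q, T.transStar w q = T.transStar w q'

/-- `T` is synchronizing if it is synchronizing at some level. -/
def Synchronizing (T : Transducer n) : Prop := ∃ k, T.SyncAtLevel k

/-- `T` (inducing the homeomorphism `h` at `q0`) is one-way synchronizing: `T` is
synchronizing, but the inverse homeomorphism is not induced by any finite
synchronizing transducer (equivalently, the inverse transducer is not synchronizing). -/
def OneWaySync (T : Transducer n) (q0 : T.Q) (h : Cantor n ≃ₜ Cantor n) : Prop :=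
  T.Induces q0 ⇑h ∧ T.Synchronizing ∧
    ¬ ∃ (S : Transducer n) (_ : Finite S.Q) (s0 : S.Q),
        S.Induces s0 ⇑h.symm ∧ S.Synchronizing

/-- `T` is equal to its core : every state is reached by reading a word of length `k`
from some state, for every synchronizing level `k`. -/
def EqualToCore (T : Transducer n) : Prop :=
  ∀ k : ℕ, T.SyncAtLevel k → ∀ q : T.Q, ∃ (w : List (Fin n)) (p : T.Q),
    w.length = k ∧ T.transStar w p = q

/-- Every state of `T` is accessible from `q0`. -/
def Accessible (T : Transducer n) (q0 : T.Q) : Prop :=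
  ∀ q : T.Q, ∃ w : List (Fin n), T.transStar w q0 = q

/-- The product transducer `T S` (first act by `T`, then by `S`). -/
def prod (T S : Transducer n) : Transducer n where
  Q := T.Q × S.Q
  tr := fun x p => (T.tr x p.1, S.transStar (T.out x p.1) p.2)
  out := fun x p => S.outStar (T.out x p.1) p.2

/-- `T` is partially invertible: every state induces an injective map on Cantor space
with clopen image. -/
def PartiallyInvertible (T : Transducer n) : Prop :=
  ∀ q : T.Q, ∃ f : Cantor n → Cantor n,
    T.Induces q f ∧ Function.Injective f ∧ IsClopen (Set.range f)

/-- `T` has no states of incomplete response: for each state `q` and letter `i`, no word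
strictly longer than `λ(i,q)` is a common prefix of the outputs on all of the cone `[i]`. -/
def NoIncompleteResponse (T : Transducer n) : Prop :=
  ∀ (q : T.Q) (i x : Fin n),
    ¬ ∀ χ : Cantor n, ∃ k : ℕ, (T.out i q ++ [x]) <+: T.outStar (i :: takeW χ k) q

/-- States `q` of `T` and `p` of `S` are `ω`-equivalent: they induce one and the same
map on Cantor space. -/
def OmegaEq (T : Transducer n) (q : T.Q) (S : Transducer n) (p : S.Q) : Prop :=
  ∃ f : Cantor n → Cantor n, T.Induces q f ∧ S.Induces p f

/-- `T` is minimal: no states of incomplete response and no pair of distinct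
`ω`-equivalent states. -/
def Minimal (T : Transducer n) : Prop :=
  T.NoIncompleteResponse ∧ ∀ q q' : T.Q, T.OmegaEq q T q' → q = q'

/-- The map on Cantor space induced by the state `q` (junk value if none exists). -/
def inducedMap (T : Transducer n) (q : T.Q) : Cantor n → Cantor n :=
  if h : ∃ f, T.Induces q f then h.choose else id

/-- `𝓛_q(α)`: the longest common prefix of the preimage of the cone `[α]` under `T_q`
(junk value if it does not exist). -/
def lcp (T : Transducer n) (q : T.Q) (α : List (Fin n)) : List (Fin n) :=
  if h : ∃ l, IsLCP {ρ : Cantor n | T.inducedMap q ρ ∈ cone α} l then h.choose else []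

/-- The inverse transducer of `T` given by the inversion algorithm, on the set of all
pairs `(w, q)`: reading `x` from `(w,q)` outputs `𝓛_q(wx)` and moves to
`(wx - λ(𝓛_q(wx), q), π(𝓛_q(wx), q))`. -/
def invT (T : Transducer n) : Transducer n where
  Q := List (Fin n) × T.Q
  tr := fun x p =>
    ((p.1 ++ [x]).drop (T.outStar (T.lcp p.2 (p.1 ++ [x])) p.2).length,
      T.transStar (T.lcp p.2 (p.1 ++ [x])) p.2)
  out := fun x p => T.lcp p.2 (p.1 ++ [x])

/-- Restriction of a transducer to a set of states (transitions leaving the set are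
replaced by junk loops; for transition-closed sets this is the honest restriction). -/
def restrictTo (T : Transducer n) (P : T.Q → Prop) : Transducer n where
  Q := {q : T.Q // P q}
  tr := fun x q => if h : P (T.tr x q.1) then ⟨T.tr x q.1, h⟩ else q
  out := fun x q => T.out x q.1

/-- The set of states reachable from `q0`. -/
def reach (T : Transducer n) (q0 : T.Q) : T.Q → Prop :=
  fun q => ∃ w : List (Fin n), T.transStar w q0 = q

/-- The inverse transducer of the initial transducer `T_{q0}`, with state set the states
accessible from `(ε, q0)`. -/
def invAcc (T : Transducer n) (q0 : T.Q) : Transducer n :=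
  (T.invT).restrictTo ((T.invT).reach ([], q0))

/-- A pair `(w,p)` is good if `[w] ⊆ im(T_p)` and `𝓛_p(w) = ε`. -/
def GoodPair (T : Transducer n) (p : List (Fin n) × T.Q) : Prop :=
  cone p.1 ⊆ T.stateImage p.2 ∧
    IsLCP {ρ : Cantor n | T.inducedMap p.2 ρ ∈ cone p.1} []

/-- The partial inverse `T'` of a partially invertible transducer `T`: the inverse
transducer restricted to the good pairs `(w,p)` with `[w] ⊆ im(T_p)`, `𝓛_p(w) = ε`. -/
def partialInv (T : Transducer n) : Transducer n :=
  (T.invT).restrictTo T.GoodPair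

/-- `h` is a completion of `T`: there are a maximal antichain `η` and an effective viable
combination `(ρ, p)` such that `h` maps `η_i χ` to `ρ_i (χ)T_{p_i}`. -/
def IsCompletion (T : Transducer n) (h : Cantor n ≃ₜ Cantor n) : Prop :=
  ∃ (l : ℕ) (η ρ : Fin l → List (Fin n)) (p : Fin l → T.Q)
      (f : Fin l → (Cantor n → Cantor n)),
    l % (n - 1) = 1 % (n - 1) ∧
    AntichainFam η ∧
    (∀ i, T.Induces (p i) (f i)) ∧
    (⋃ i, appendInf (ρ i) '' Set.range (f i)) = Set.univ ∧
    (∀ i j, i ≠ j →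
      Disjoint (appendInf (ρ i) '' Set.range (f i))
        (appendInf (ρ j) '' Set.range (f j))) ∧
    ∀ (i : Fin l) (χ : Cantor n), h (appendInf (η i) χ) = appendInf (ρ i) (f i χ)

/-- The group `𝓗(T)` generated by all completions of `T`. -/
def HGroup (T : Transducer n) : Subgroup (Cantor n ≃ₜ Cantor n) :=
  Subgroup.closure {h | T.IsCompletion h}

/-- The subgroup-generating equivalence relation induced by the automaton underlying a
transducer `A` with start state `a0` (by Lemma 4.1, two words are related iff the states
they reach are identified by the collapsing procedure, i.e. iff the reached states
transition identically on all sufficiently long words). -/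
def simA (A : Transducer n) (a0 : A.Q) (α β : List (Fin n)) : Prop :=
  ∃ i : ℕ, ∀ w : List (Fin n), w.length = i →
    A.transStar w (A.transStar α a0) = A.transStar w (A.transStar β a0)

/-- `if b then T else T'`. -/
def factor (T : Transducer n) (b : Bool) : Transducer n :=
  if b then T else T.partialInv

/-- The product of a nonempty list of factors, each equal to `T` or its partial
inverse `T'`; these products make up the set `Π(T)`. -/
def prodOf (T : Transducer n) : List Bool → Transducer n
  | [] => T
  | [b] => T.factor b
  | b :: c :: rest => (T.factor b).prod (T.prodOf (c :: rest))

/-- `T` is contracting: every state of every product of copies of `T` and `T'` is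
`ω`-equivalent to an initial transducer which, after reading some fixed length of input,
always acts as a state of `T`. -/
def Contracting (T : Transducer n) : Prop :=
  ∀ L : List Bool, L ≠ [] → ∀ q : (T.prodOf L).Q,
    ∃ (V : Transducer n) (p : V.Q) (f : Cantor n → Cantor n),
      (T.prodOf L).Induces q f ∧ V.Induces p f ∧
      ∃ j : ℕ, ∀ w : List (Fin n), w.length = j →
        ∃ (u : T.Q) (g : Cantor n → Cantor n),
          V.Induces (V.transStar w p) g ∧ T.Induces u g

end Transducer

/-- The element `v` of `Vₙ` preserves the relation `r` on nonempty finite words: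
whenever `v` replaces the prefix `α` by `β`, the words `α` and `β` are related. -/
def PreservesRel {n : ℕ} (r : List (Fin n) → List (Fin n) → Prop)
    (g : Cantor n ≃ₜ Cantor n) : Prop :=
  ∀ (α β : List (Fin n)), α ≠ [] → β ≠ [] →
    (∀ χ : Cantor n, g (appendInf α χ) = appendInf β χ) → r α β

/-- The subgroup `V_∼` of `Vₙ` generated by the prefix-exchange homeomorphisms
preserving the relation `r`. -/
def VSim (n : ℕ) (r : List (Fin n) → List (Fin n) → Prop) :
    Subgroup (Cantor n ≃ₜ Cantor n) :=
  Subgroup.closure {g | g ∈ Vn n ∧ PreservesRel r g}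

/-- `f` coincides with `g` on the cone `[α]` (conjugated into the cone) and is the
identity off the cone: the homeomorphism `[α]_g`. -/
def IsRestrTo {n : ℕ} (α : List (Fin n)) (g f : Cantor n ≃ₜ Cantor n) : Prop :=
  (∀ χ : Cantor n, f (appendInf α χ) = appendInf α (g χ)) ∧
  ∀ χ : Cantor n, ¬ PrefixOf α χ → f χ = χ

/-- The Nekrashevych group `Vₙ(G)`: the group generated by `Vₙ` together with all the
homeomorphisms `[α]_g` for `g ∈ G`. -/
def NekG (n : ℕ) (G : Subgroup (Cantor n ≃ₜ Cantor n)) :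
    Subgroup (Cantor n ≃ₜ Cantor n) :=
  Subgroup.closure (Vn n ∪ {f | ∃ (α : List (Fin n)) (g : Cantor n ≃ₜ Cantor n),
    g ∈ G ∧ IsRestrTo α g f})

/-- The homeomorphism `f` locally agrees with the set `G` of homeomorphisms. -/
def LocallyAgrees {n : ℕ} (G : Set (Cantor n ≃ₜ Cantor n))
    (f : Cantor n ≃ₜ Cantor n) : Prop :=
  ∀ x : Cantor n, ∃ U : Set (Cantor n), IsOpen U ∧ x ∈ U ∧
    ∃ g ∈ G, Set.EqOn ⇑f ⇑g U

/-- A finite synchronous invertible transducer over `Fin n`: each state rewrites single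
letters to single letters bijectively. -/
structure SyncTransducer (n : ℕ) where
  /-- the set of states -/
  Q : Type
  /-- there are finitely many states -/
  fin : Finite Q
  /-- the transition function -/
  tr : Fin n → Q → Q
  /-- the (single-letter) output function -/
  out : Fin n → Q → Fin n
  /-- each state rewrites letters bijectively -/
  bij : ∀ q : Q, Function.Bijective fun x => out x q

namespace SyncTransducer

variable {n : ℕ}

/-- The transition function extended to finite words. -/
def trStar (U : SyncTransducer n) : List (Fin n) → U.Q → U.Q
  | [], q => q
  | x :: w, q => U.trStar w (U.tr x q)

/-- The output function extended to finite words. -/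
def outWord (U : SyncTransducer n) : List (Fin n) → U.Q → List (Fin n)
  | [], _ => []
  | x :: w, q => U.out x q :: U.outWord w (U.tr x q)

/-- The map on Cantor space induced by the initial transducer `U_q`. -/
def applyFun (U : SyncTransducer n) (q : U.Q) (χ : Cantor n) : Cantor n :=
  fun i => U.out (χ i) (U.trStar (takeW χ i) q)

/-- The inverse transducer of a synchronous invertible transducer. -/
def inv (U : SyncTransducer n) : SyncTransducer n where
  Q := U.Q
  fin := U.fin
  tr := fun y q => U.tr ((Equiv.ofBijective _ (U.bij q)).symm y) q
  out := fun y q => (Equiv.ofBijective _ (U.bij q)).symm y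
  bij := fun q => (Equiv.ofBijective _ (U.bij q)).symm.bijective

/-- The product of synchronous transducers (first act by `T`, then by `S`). -/
def sprod (T S : SyncTransducer n) : SyncTransducer n where
  Q := T.Q × S.Q
  fin := by
    haveI := T.fin; haveI := S.fin
    infer_instance
  tr := fun x p => (T.tr x p.1, S.tr (T.out x p.1) p.2)
  out := fun x p => S.out (T.out x p.1) p.2
  bij := fun p => (S.bij p.2).comp (T.bij p.1)

/-- `U` is synchronizing at level `k`. -/
def SyncAtLevel (U : SyncTransducer n) (k : ℕ) : Prop :=
  ∀ w : List (Fin n), w.length = k → ∀ q q' : U.Q, U.trStar w q = U.trStar w q'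

/-- `U` is synchronizing. -/
def Synchronizing (U : SyncTransducer n) : Prop := ∃ k, U.SyncAtLevel k

/-- `U` is minimal (under `ω`-equivalence): distinct states induce distinct maps. -/
def Minimal (U : SyncTransducer n) : Prop :=
  ∀ q q' : U.Q, U.applyFun q = U.applyFun q' → q = q'

/-- One-way synchronizing: `U` is synchronizing but the inverse homeomorphism of
`h = U_{q0}` is not induced by any finite synchronizing transducer. -/
def OneWaySync (U : SyncTransducer n) (h : Cantor n ≃ₜ Cantor n) : Prop :=
  U.Synchronizing ∧
    ¬ ∃ (S : Transducer n) (_ : Finite S.Q) (s0 : S.Q),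
        S.Induces s0 ⇑h.symm ∧ S.Synchronizing

/-- `U` is equal to its core. -/
def EqualToCore (U : SyncTransducer n) : Prop :=
  ∀ k : ℕ, U.SyncAtLevel k → ∀ q : U.Q, ∃ (w : List (Fin n)) (p : U.Q),
    w.length = k ∧ U.trStar w p = q

/-- The underlying (asynchronous-format) transducer of a synchronous transducer. -/
def toT (U : SyncTransducer n) : Transducer n :=
  ⟨U.Q, U.tr, fun x q => [U.out x q]⟩

/-- The automaton group `𝒢(U)` generated by `U`: the subgroup of the homeomorphism
group of Cantor space generated by the homeomorphisms `U_q` for the states `q`. -/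
def autG (U : SyncTransducer n) : Subgroup (Cantor n ≃ₜ Cantor n) :=
  Subgroup.closure {f : Cantor n ≃ₜ Cantor n | ∃ q : U.Q, ⇑f = U.applyFun q}

end SyncTransducer

namespace Cantor

variable {n : ℕ}

/-- The infinite word obtained by deleting the first `a` letters of `χ`. -/
def drop (a : ℕ) (χ : Cantor n) : Cantor n := fun i => χ (a + i)

/-- The infinite words `x` and `y` have the same first `a` letters. -/
def Agree (a : ℕ) (x y : Cantor n) : Prop := ∀ i < a, x i = y i

lemma drop_drop (a b : ℕ) (χ : Cantor n) : drop b (drop a χ) = drop (a + b) χ := by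
  funext i
  simp [drop, add_assoc]

lemma Agree.symm {a : ℕ} {x y : Cantor n} (h : Agree a x y) : Agree a y x :=
  fun i hi => (h i hi).symm

lemma Agree.trans {a : ℕ} {x y z : Cantor n} (h : Agree a x y) (h' : Agree a y z) :
    Agree a x z :=
  fun i hi => (h i hi).trans (h' i hi)

lemma Agree.mono {a b : ℕ} {x y : Cantor n} (h : Agree a x y) (hab : b ≤ a) : Agree b x y :=
  fun i hi => h i (hi.trans_le hab)

lemma agree_add_iff {a t : ℕ} {x y : Cantor n} :
    Agree (a + t) x y ↔ Agree a x y ∧ Agree t (drop a x) (drop a y) := by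
  refine ⟨fun h => ⟨h.mono (Nat.le_add_right _ _), fun i hi => h _ (by omega)⟩, ?_⟩
  rintro ⟨h, h'⟩ i hi
  rcases lt_or_ge i a with hia | hia
  · exact h i hia
  · obtain ⟨j, rfl⟩ := Nat.exists_eq_add_of_le hia
    exact h' j (by omega)

lemma eq_of_agree_of_drop {a : ℕ} {x y : Cantor n} (h : Agree a x y)
    (h' : drop a x = drop a y) : x = y := by
  funext i
  rcases lt_or_ge i a with hia | hia
  · exact h i hia
  · obtain ⟨j, rfl⟩ := Nat.exists_eq_add_of_le hia
    exact congrFun h' j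

lemma length_takeW (χ : Cantor n) (k : ℕ) : (takeW χ k).length = k := by
  simp [takeW]

lemma takeW_eq_iff {k : ℕ} {x y : Cantor n} : takeW x k = takeW y k ↔ Agree k x y := by
  unfold takeW
  rw [List.ofFn_inj]
  exact ⟨fun h i hi => congrFun h ⟨i, hi⟩, fun h => funext fun i => h i i.2⟩

lemma takeW_succ (χ : Cantor n) (k : ℕ) : takeW χ (k + 1) = takeW χ k ++ [χ k] := by
  unfold takeW
  rw [List.ofFn_succ']
  simp

lemma prefixOf_appendInf (w : List (Fin n)) (χ : Cantor n) : PrefixOf w (appendInf w χ) := by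
  intro i hi
  simp [appendInf, hi]

lemma drop_appendInf (w : List (Fin n)) (χ : Cantor n) :
    drop w.length (appendInf w χ) = χ := by
  funext i
  simp [drop, appendInf]

lemma PrefixOf.agree {w : List (Fin n)} {x y : Cantor n} (hx : PrefixOf w x)
    (hy : PrefixOf w y) : Agree w.length x y :=
  fun i hi => (hx i hi).symm.trans (hy i hi)

lemma PrefixOf.of_agree {w : List (Fin n)} {x y : Cantor n} (hx : PrefixOf w x)
    (h : Agree w.length x y) : PrefixOf w y :=
  fun i hi => (hx i hi).trans (h i hi)

lemma PrefixOf.appendInf_drop {w : List (Fin n)} {χ : Cantor n} (h : PrefixOf w χ) :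
    appendInf w (drop w.length χ) = χ :=
  eq_of_agree_of_drop (PrefixOf.agree (prefixOf_appendInf w _) h) (drop_appendInf _ _)

lemma prefixOf_iff_exists {w : List (Fin n)} {χ : Cantor n} :
    PrefixOf w χ ↔ ∃ ξ, appendInf w ξ = χ :=
  ⟨fun h => ⟨_, PrefixOf.appendInf_drop h⟩, fun ⟨ξ, h⟩ => h ▸ prefixOf_appendInf w ξ⟩

lemma prefixOf_takeW (χ : Cantor n) (k : ℕ) : PrefixOf (takeW χ k) χ := by
  intro i hi
  simp [takeW]

lemma prefixOf_takeW_iff {k : ℕ} {x y : Cantor n} : PrefixOf (takeW x k) y ↔ Agree k x y := by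
  constructor
  · intro h
    simpa [length_takeW] using PrefixOf.agree (prefixOf_takeW x k) h
  · intro h
    exact PrefixOf.of_agree (prefixOf_takeW x k) (by simpa [length_takeW] using h)

lemma isOpen_agree (k : ℕ) (x : Cantor n) : IsOpen {y | Agree k x y} := by
  have : {y : Cantor n | Agree k x y} = ⋂ i : Fin k, (fun y => y i) ⁻¹' {x i} := by
    ext y
    simp only [Set.mem_iInter, Set.mem_preimage, Set.mem_singleton_iff]
    exact ⟨fun h i => (h i i.2).symm, fun h i hi => (h ⟨i, hi⟩).symm⟩
  rw [this]
  exact isOpen_iInter_of_finite fun i => (isOpen_discrete _).preimage (continuous_apply i.1)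

lemma isOpen_of_agree {s : Set (Cantor n)} (k : ℕ) (h : ∀ x ∈ s, ∀ y, Agree k x y → y ∈ s) :
    IsOpen s :=
  isOpen_iff_forall_mem_open.2 fun x hx =>
    ⟨{y | Agree k x y}, h x hx, isOpen_agree k x, fun _ _ => rfl⟩

lemma continuous_of_agree {D : Type*} [TopologicalSpace D] {f : Cantor n → D} (k : ℕ)
    (h : ∀ x y, Agree k x y → f x = f y) : Continuous f :=
  continuous_def.2 fun s _ => isOpen_of_agree k fun x hx y hxy => by
    rwa [Set.mem_preimage, ← h x y hxy]

lemma continuous_appendInf (w : List (Fin n)) :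
    Continuous (appendInf w : Cantor n → Cantor n) := by
  refine continuous_pi fun i => ?_
  by_cases h : i < w.length
  · simpa [appendInf, h] using continuous_const
  · simpa [appendInf, h] using continuous_apply (i - w.length)

lemma continuous_drop (a : ℕ) : Continuous (drop a : Cantor n → Cantor n) :=
  continuous_pi fun i => continuous_apply (a + i)

lemma isClopen_prefixOf (w : List (Fin n)) : IsClopen {χ : Cantor n | PrefixOf w χ} :=
  ⟨⟨isOpen_of_agree w.length fun _ hx _ hxy hy => hx (PrefixOf.of_agree hy hxy.symm)⟩,
    isOpen_of_agree w.length fun _ hx _ hxy => PrefixOf.of_agree hx hxy⟩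

/-- `v` replaces the prefix of `x` of length `a` by the prefix of `v x` of length `b`. -/
def PrefixExchangeAt (v : Cantor n ≃ₜ Cantor n) (x : Cantor n) (a b : ℕ) : Prop :=
  ∀ y, Agree a x y → Agree b (v x) (v y) ∧ drop b (v y) = drop a y

lemma PrefixExchangeAt.add {v : Cantor n ≃ₜ Cantor n} {x : Cantor n} {a b : ℕ}
    (h : PrefixExchangeAt v x a b) (t : ℕ) : PrefixExchangeAt v x (a + t) (b + t) := by
  intro y hy
  obtain ⟨hy₁, hy₂⟩ := agree_add_iff.1 hy
  obtain ⟨h₁, h₂⟩ := h y hy₁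
  obtain ⟨-, h₃⟩ := h x fun _ _ => rfl
  refine ⟨agree_add_iff.2 ⟨h₁, by rwa [h₂, h₃]⟩, ?_⟩
  rw [← drop_drop, h₂, drop_drop]

lemma PrefixExchangeAt.congr {v : Cantor n ≃ₜ Cantor n} {x z : Cantor n} {a b : ℕ}
    (h : PrefixExchangeAt v x a b) (hz : Agree a x z) : PrefixExchangeAt v z a b := by
  intro y hy
  exact ⟨(h z hz).1.symm.trans (h y (hz.trans hy)).1, (h y (hz.trans hy)).2⟩

/-- The homeomorphisms which locally exchange finite prefixes. -/
def prefixExchange (n : ℕ) : Subgroup (Cantor n ≃ₜ Cantor n) where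
  carrier := {v | ∀ x, ∃ a b, PrefixExchangeAt v x a b}
  one_mem' := fun _ => ⟨0, 0, fun _ hy => ⟨hy, rfl⟩⟩
  mul_mem' := by
    intro f g hf hg x
    obtain ⟨a, b, h⟩ := hg x
    obtain ⟨c, d, h'⟩ := hf (g x)
    refine ⟨a + c, d + b, fun y hy => ?_⟩
    obtain ⟨h₁, h₂⟩ := h.add c y hy
    obtain ⟨h₃, h₄⟩ := h'.add b (g y) (by rwa [add_comm])
    refine ⟨h₃, h₄.trans ?_⟩
    rw [← h₂, add_comm]
  inv_mem' := by
    intro f hf x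
    obtain ⟨a, b, h⟩ := hf (f.symm x)
    refine ⟨b, a, fun y hy => ?_⟩
    rw [PrefixExchangeAt, f.apply_symm_apply] at h
    set z : Cantor n := appendInf (takeW (f.symm x) a) (drop b y) with hz
    have hz₁ : Agree a (f.symm x) z := prefixOf_takeW_iff.1 (prefixOf_appendInf _ _)
    have hz₂ : drop a z = drop b y := by
      have := drop_appendInf (takeW (f.symm x) a) (drop b y)
      rwa [length_takeW] at this
    obtain ⟨h₁, h₂⟩ := h z hz₁
    have hfz : f z = y := eq_of_agree_of_drop (h₁.symm.trans hy) (h₂.trans hz₂)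
    have hy' : f.symm y = z := by rw [← hfz, f.symm_apply_apply]
    change Agree a (f.symm x) (f.symm y) ∧ drop a (f.symm y) = drop b y
    rw [hy']
    exact ⟨hz₁, hz₂⟩

lemma exists_uniform_prefixExchangeAt {v : Cantor n ≃ₜ Cantor n}
    (hv : v ∈ prefixExchange n) : ∃ N, ∀ x, ∃ b, PrefixExchangeAt v x N b := by
  choose a b hab using hv
  obtain ⟨s, hs⟩ := isCompact_univ.elim_finite_subcover (fun x => {y | Agree (a x) x y})
    (fun x => isOpen_agree _ _) fun x _ => Set.mem_iUnion.2 ⟨x, fun _ _ => rfl⟩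
  refine ⟨s.sup a, fun x => ?_⟩
  obtain ⟨z, hz, hx⟩ := Set.mem_iUnion₂.1 (hs (Set.mem_univ x))
  obtain ⟨t, ht⟩ := Nat.exists_eq_add_of_le (Finset.le_sup (f := a) hz)
  exact ⟨b z + t, ht ▸ ((hab z).congr hx).add t⟩

lemma antichainFam_of_apply {m : ℕ} {α β : Fin m → List (Fin n)} (hα : AntichainFam α)
    {e : Cantor n ≃ Cantor n} (he : ∀ i χ, PrefixOf (α i) χ ↔ PrefixOf (β i) (e χ)) :
    AntichainFam β := by
  intro χ
  have := hα (e.symm χ)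
  simpa [he] using this

theorem coe_prefixExchange (hn : 0 < n) : (prefixExchange n : Set _) = Vn n := by
  ext v
  constructor
  · intro hv
    obtain ⟨N, hN⟩ := exists_uniform_prefixExchangeAt hv
    choose b hb using hN
    let e := Fintype.equivFin (Fin N → Fin n)
    let p : Fin (Fintype.card (Fin N → Fin n)) → Cantor n := fun i =>
      appendInf (List.ofFn (e.symm i)) fun _ => ⟨0, hn⟩
    have hp : ∀ i (j : Fin N), p i j = e.symm i j := by
      intro i j
      simp [p, appendInf]
    have hα : AntichainFam fun i => takeW (p i) N := by
      intro χ
      refine ⟨e fun j => χ j, prefixOf_takeW_iff.2 fun j hj => ?_, fun i hi => ?_⟩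
      · simpa using hp (e fun j => χ j) ⟨j, hj⟩
      · rw [← e.symm_apply_eq]
        funext j
        rw [← hp]
        exact prefixOf_takeW_iff.1 hi j j.2
    have key : ∀ i χ, v (appendInf (takeW (p i) N) χ) =
        appendInf (takeW (v (p i)) (b (p i))) χ := by
      intro i χ
      obtain ⟨h₁, h₂⟩ := hb (p i) (appendInf (takeW (p i) N) χ)
        (prefixOf_takeW_iff.1 (prefixOf_appendInf _ _))
      have h₃ := drop_appendInf (takeW (p i) N) χ
      have h₄ := drop_appendInf (takeW (v (p i)) (b (p i))) χ
      rw [length_takeW] at h₃ h₄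
      exact eq_of_agree_of_drop
        (h₁.symm.trans (prefixOf_takeW_iff.1 (prefixOf_appendInf _ _)))
        (h₂.trans (h₃.trans h₄.symm))
    refine ⟨_, _, _, hα, antichainFam_of_apply (e := v.toEquiv) hα fun i χ => ?_, key⟩
    simp only [prefixOf_iff_exists]
    refine exists_congr fun ξ => ?_
    rw [← key]
    exact v.injective.eq_iff.symm
  · rintro ⟨m, α, β, hα, hβ, h⟩ x
    obtain ⟨i, hi, -⟩ := hα x
    refine ⟨(α i).length, (β i).length, fun y hy => ?_⟩
    have hx := h i (drop (α i).length x)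
    have hy' := h i (drop (α i).length y)
    rw [PrefixOf.appendInf_drop hi] at hx
    rw [PrefixOf.appendInf_drop (PrefixOf.of_agree hi hy)] at hy'
    rw [hx, hy']
    exact ⟨PrefixOf.agree (prefixOf_appendInf _ _) (prefixOf_appendInf _ _),
      drop_appendInf _ _⟩

/-- The map acting as `g` behind the prefix `α` and fixing all points without that prefix. -/
def restrMap (α : List (Fin n)) (g : Cantor n → Cantor n) (χ : Cantor n) : Cantor n :=
  if PrefixOf α χ then appendInf α (g (drop α.length χ)) else χ

lemma restrMap_appendInf (α : List (Fin n)) (g : Cantor n → Cantor n) (χ : Cantor n) :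
    restrMap α g (appendInf α χ) = appendInf α (g χ) := by
  rw [restrMap, if_pos (prefixOf_appendInf _ _), drop_appendInf]

lemma restrMap_of_not_prefixOf {α : List (Fin n)} (g : Cantor n → Cantor n) {χ : Cantor n}
    (h : ¬ PrefixOf α χ) : restrMap α g χ = χ :=
  if_neg h

lemma leftInverse_restrMap (α : List (Fin n)) {f g : Cantor n → Cantor n}
    (h : Function.LeftInverse f g) : Function.LeftInverse (restrMap α f) (restrMap α g) := by
  intro χ
  by_cases hχ : PrefixOf α χ
  · obtain ⟨ξ, rfl⟩ := prefixOf_iff_exists.1 hχ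
    rw [restrMap_appendInf, restrMap_appendInf, h]
  · rw [restrMap_of_not_prefixOf g hχ, restrMap_of_not_prefixOf f hχ]

lemma continuous_restrMap (α : List (Fin n)) {g : Cantor n → Cantor n} (hg : Continuous g) :
    Continuous (restrMap α g) := by
  refine Continuous.if ?_ ((continuous_appendInf α).comp (hg.comp (continuous_drop _)))
    continuous_id
  intro χ hχ
  rw [(isClopen_prefixOf α).frontier_eq] at hχ
  exact hχ.elim

lemma exists_isRestrTo (α : List (Fin n)) (g : Cantor n ≃ₜ Cantor n) :
    ∃ f, IsRestrTo α g f :=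
  ⟨{ toFun := restrMap α g
     invFun := restrMap α g.symm
     left_inv := leftInverse_restrMap α g.symm_apply_apply
     right_inv := leftInverse_restrMap α g.apply_symm_apply
     continuous_toFun := continuous_restrMap α g.continuous
     continuous_invFun := continuous_restrMap α g.symm.continuous },
    restrMap_appendInf α g, fun _ => restrMap_of_not_prefixOf g⟩

lemma exists_mem_NekG_of_antichainFam {G : Subgroup (Cantor n ≃ₜ Cantor n)} {m : ℕ}
    {α : Fin m → List (Fin n)} (hα : AntichainFam α) {g : Fin m → (Cantor n ≃ₜ Cantor n)}
    (hg : ∀ i, g i ∈ G) :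
    ∃ f ∈ NekG n G, ∀ i χ, f (appendInf (α i) χ) = appendInf (α i) (g i χ) := by
  suffices ∀ s : Finset (Fin m), ∃ f ∈ NekG n G, ∀ i χ,
      f (appendInf (α i) χ) = appendInf (α i) (if i ∈ s then g i χ else χ) by
    simpa using this Finset.univ
  intro s
  induction s using Finset.induction_on with
  | empty => exact ⟨1, one_mem _, fun i χ => by simp⟩
  | insert j s hj ih =>
    obtain ⟨f, hf, hf'⟩ := ih
    obtain ⟨r, hr⟩ := exists_isRestrTo (α j) (g j)
    refine ⟨r * f, mul_mem (Subgroup.subset_closure (Or.inr ⟨_, _, hg j, hr⟩)) hf,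
      fun i χ => ?_⟩
    change r (f _) = _
    rw [hf']
    by_cases hij : i = j
    · subst hij
      simp [hj, hr.1]
    · rw [hr.2 _ fun h => hij ((hα _).unique (prefixOf_appendInf _ _) h)]
      simp [hij]

/-- A homeomorphism which exchanges prefixes up to elements of `G` lies in `Vₙ(G)`. -/
theorem mem_NekG_of_antichainFam {G : Subgroup (Cantor n ≃ₜ Cantor n)} {m : ℕ}
    {α β : Fin m → List (Fin n)} (hα : AntichainFam α) (hβ : AntichainFam β)
    {g : Fin m → (Cantor n ≃ₜ Cantor n)} (hg : ∀ i, g i ∈ G) {f : Cantor n ≃ₜ Cantor n}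
    (hf : ∀ i χ, f (appendInf (α i) χ) = appendInf (β i) (g i χ)) : f ∈ NekG n G := by
  obtain ⟨r, hr, hr'⟩ := exists_mem_NekG_of_antichainFam hα hg
  have hv : f * r⁻¹ ∈ Vn n := by
    refine ⟨m, α, β, hα, hβ, fun i χ => ?_⟩
    change f (r.symm _) = _
    have : r.symm (appendInf (α i) χ) = appendInf (α i) ((g i).symm χ) := by
      rw [Homeomorph.symm_apply_eq, hr', Homeomorph.apply_symm_apply]
    rw [this, hf, Homeomorph.apply_symm_apply]
  have hfr : f * r⁻¹ ∈ NekG n G := Subgroup.subset_closure (Or.inl hv)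
  simpa only [inv_mul_cancel_right] using mul_mem hfr hr

end Cantor

namespace SyncTransducer

open Cantor

variable {n : ℕ} (U : SyncTransducer n)

/-- The state reached from `q` after reading the first `k` letters of `χ`. -/
def stateAt (q : U.Q) (χ : Cantor n) (k : ℕ) : U.Q := U.trStar (takeW χ k) q

lemma trStar_append (w w' : List (Fin n)) (q : U.Q) :
    U.trStar (w ++ w') q = U.trStar w' (U.trStar w q) := by
  induction w generalizing q with
  | nil => rfl
  | cons x w ih => exact ih _

lemma stateAt_zero (q : U.Q) (χ : Cantor n) : U.stateAt q χ 0 = q := by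
  simp [stateAt, takeW, trStar]

lemma stateAt_succ (q : U.Q) (χ : Cantor n) (k : ℕ) :
    U.stateAt q χ (k + 1) = U.tr (χ k) (U.stateAt q χ k) := by
  rw [stateAt, takeW_succ, trStar_append]
  rfl

lemma stateAt_add (q : U.Q) (χ : Cantor n) (a k : ℕ) :
    U.stateAt q χ (a + k) = U.stateAt (U.stateAt q χ a) (Cantor.drop a χ) k := by
  induction k with
  | zero => rw [stateAt_zero, add_zero]
  | succ k ih => rw [← add_assoc, stateAt_succ, ih, stateAt_succ]; rfl

lemma applyFun_apply (q : U.Q) (χ : Cantor n) (i : ℕ) :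
    U.applyFun q χ i = U.out (χ i) (U.stateAt q χ i) :=
  rfl

lemma drop_applyFun (q : U.Q) (χ : Cantor n) (a : ℕ) :
    Cantor.drop a (U.applyFun q χ) = U.applyFun (U.stateAt q χ a) (Cantor.drop a χ) := by
  funext i
  change U.applyFun q χ (a + i) = _
  rw [applyFun_apply, applyFun_apply, stateAt_add]
  rfl

lemma stateAt_congr (q : U.Q) {x y : Cantor n} {k : ℕ} (h : Agree k x y) :
    U.stateAt q x k = U.stateAt q y k := by
  rw [stateAt, takeW_eq_iff.2 h, stateAt]

lemma agree_applyFun_iff (q : U.Q) {x y : Cantor n} {k : ℕ} :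
    Agree k (U.applyFun q x) (U.applyFun q y) ↔ Agree k x y := by
  constructor
  · intro h i
    induction i using Nat.strong_induction_on with
    | _ i ih =>
      intro hi
      have := h i hi
      rw [applyFun_apply, applyFun_apply,
        U.stateAt_congr q fun j hj => ih j hj (hj.trans hi)] at this
      exact (U.bij _).injective this
  · intro h i hi
    rw [applyFun_apply, applyFun_apply, h i hi, U.stateAt_congr q (h.mono hi.le)]

lemma continuous_applyFun (q : U.Q) : Continuous (U.applyFun q) :=
  continuous_pi fun i => continuous_of_agree (i + 1) fun _ _ h =>
    (U.agree_applyFun_iff q).2 h i i.lt_succ_self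

variable {U} in
lemma stateAt_eq_of_run {χ : Cantor n} {σ : ℕ → U.Q} (h : ∀ k, σ (k + 1) = U.tr (χ k) (σ k))
    (k : ℕ) : U.stateAt (σ 0) χ k = σ k := by
  induction k with
  | zero => exact U.stateAt_zero _ _
  | succ k ih => rw [stateAt_succ, ih, h]

variable {U} in
lemma applyFun_eq_of_run {χ : Cantor n} {σ : ℕ → U.Q} (h : ∀ k, σ (k + 1) = U.tr (χ k) (σ k)) :
    U.applyFun (σ 0) χ = fun i => U.out (χ i) (σ i) :=
  funext fun i => congrArg (U.out (χ i)) (stateAt_eq_of_run h i)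

lemma inv_applyFun_applyFun (q : U.Q) (χ : Cantor n) :
    U.inv.applyFun q (U.applyFun q χ) = χ := by
  have hout : ∀ k, (Equiv.ofBijective _ (U.bij (U.stateAt q χ k))).symm (U.applyFun q χ k) = χ k :=
    fun k => Equiv.ofBijective_symm_apply_apply (fun x => U.out x (U.stateAt q χ k)) _ _
  refine (applyFun_eq_of_run (U := U.inv) (σ := U.stateAt q χ) fun k => ?_).trans (funext hout)
  exact (U.stateAt_succ q χ k).trans
    (congrArg (fun x => U.tr x (U.stateAt q χ k)) (hout k).symm)

lemma applyFun_inv_applyFun (q : U.Q) (χ : Cantor n) :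
    U.applyFun q (U.inv.applyFun q χ) = χ := by
  refine (applyFun_eq_of_run (U := U) (χ := U.inv.applyFun q χ) (σ := U.inv.stateAt q χ)
    (U.inv.stateAt_succ q χ)).trans (funext fun i => ?_)
  exact Equiv.ofBijective_apply_symm_apply (fun x => U.out x (U.inv.stateAt q χ i)) _ _

/-- The self-homeomorphism of Cantor space induced by the state `q`. -/
def stateHomeo (q : U.Q) : Cantor n ≃ₜ Cantor n where
  toFun := U.applyFun q
  invFun := U.inv.applyFun q
  left_inv := U.inv_applyFun_applyFun q
  right_inv := U.applyFun_inv_applyFun q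
  continuous_toFun := U.continuous_applyFun q
  continuous_invFun := U.inv.continuous_applyFun q

lemma applyFun_sprod (T S : SyncTransducer n) (p : T.Q) (r : S.Q) (χ : Cantor n) :
    (T.sprod S).applyFun (p, r) χ = S.applyFun r (T.applyFun p χ) :=
  applyFun_eq_of_run (U := T.sprod S)
    (σ := fun k => (T.stateAt p χ k, S.stateAt r (T.applyFun p χ) k)) fun k =>
      Prod.ext (T.stateAt_succ p χ k) (S.stateAt_succ r (T.applyFun p χ) k)

lemma coe_inv_mul_stateHomeo (p r : U.Q) :
    ⇑((U.stateHomeo r)⁻¹ * U.stateHomeo p) = (U.sprod U.inv).applyFun (p, r) :=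
  funext fun χ => (applyFun_sprod U U.inv p r χ).symm

lemma inv_mul_stateHomeo_mem_autG (p r : U.Q) :
    (U.stateHomeo r)⁻¹ * U.stateHomeo p ∈ autG (U.sprod U.inv) :=
  Subgroup.subset_closure ⟨((p, r) : U.Q × U.Q), U.coe_inv_mul_stateHomeo p r⟩

variable {U}

lemma SyncAtLevel.drop_applyFun_eq {k : ℕ} (hk : U.SyncAtLevel k) {x y : Cantor n} {a b : ℕ}
    (h : Cantor.drop a x = Cantor.drop b y) (p q : U.Q) :
    Cantor.drop (a + k) (U.applyFun p x) = Cantor.drop (b + k) (U.applyFun q y) := by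
  rw [drop_applyFun, drop_applyFun, stateAt_add, stateAt_add, h, ← drop_drop, ← drop_drop, h]
  congr 1
  exact hk _ (length_takeW _ _) _ _

lemma Synchronizing.mul_inv_mem_prefixExchange (hU : U.Synchronizing) (p q : U.Q) :
    U.stateHomeo p * (U.stateHomeo q)⁻¹ ∈ prefixExchange n := by
  obtain ⟨k, hk⟩ := hU
  intro x
  refine ⟨k, k, fun y hy => ⟨?_, ?_⟩⟩
  · exact (U.agree_applyFun_iff p).2 ((U.inv.agree_applyFun_iff q).2 hy)
  · have := hk.drop_applyFun_eq (a := 0) (b := 0) (x := U.inv.applyFun q y) rfl p q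
    rwa [applyFun_inv_applyFun, zero_add] at this

lemma Synchronizing.conj_mem_prefixExchange (hU : U.Synchronizing) (q : U.Q)
    {v : Cantor n ≃ₜ Cantor n} (hv : v ∈ prefixExchange n) :
    U.stateHomeo q * v * (U.stateHomeo q)⁻¹ ∈ prefixExchange n := by
  obtain ⟨k, hk⟩ := hU
  intro x
  obtain ⟨a, b, h⟩ := hv (U.inv.applyFun q x)
  refine ⟨a + k, b + k, fun y hy => ?_⟩
  have hy' := (U.inv.agree_applyFun_iff q).2 hy
  refine ⟨(U.agree_applyFun_iff q).2 (h.add k _ hy').1, ?_⟩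
  have := hk.drop_applyFun_eq (h _ (hy'.mono (Nat.le_add_right _ _))).2 q q
  rwa [applyFun_inv_applyFun] at this

lemma Synchronizing.conj_autG_mem_prefixExchange (hU : U.Synchronizing)
    {g : Cantor n ≃ₜ Cantor n} (hg : g ∈ autG (U.sprod U.inv)) (q : U.Q) :
    U.stateHomeo q * g * (U.stateHomeo q)⁻¹ ∈ prefixExchange n := by
  suffices autG (U.sprod U.inv) ≤
      (prefixExchange n).comap (MulAut.conj (U.stateHomeo q)).toMonoidHom from this hg
  refine (Subgroup.closure_le _).2 ?_
  rintro f ⟨⟨p, r⟩, hf⟩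
  obtain rfl : f = (U.stateHomeo r)⁻¹ * U.stateHomeo p :=
    DFunLike.coe_injective (hf.trans (U.coe_inv_mul_stateHomeo p r).symm)
  have := mul_mem (hU.mul_inv_mem_prefixExchange q r) (hU.mul_inv_mem_prefixExchange p q)
  simpa [mul_assoc] using this

lemma Synchronizing.conj_mem_prefixExchange_of_isRestrTo (hU : U.Synchronizing)
    {g f : Cantor n ≃ₜ Cantor n} (hg : g ∈ autG (U.sprod U.inv)) {α : List (Fin n)}
    (hf : IsRestrTo α g f) (q : U.Q) :
    U.stateHomeo q * f * (U.stateHomeo q)⁻¹ ∈ prefixExchange n := by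
  intro x
  obtain ⟨z, rfl⟩ := (U.stateHomeo q).surjective x
  have hconj : ∀ y, (U.stateHomeo q * f * (U.stateHomeo q)⁻¹) (U.stateHomeo q y) =
      U.stateHomeo q (f y) := fun y =>
    congrArg (fun y => U.stateHomeo q (f y)) ((U.stateHomeo q).symm_apply_apply y)
  by_cases hz : PrefixOf α z
  · set l := α.length
    set s := U.stateAt q z l
    obtain ⟨a, b, h⟩ := hU.conj_autG_mem_prefixExchange hg s (U.applyFun s (Cantor.drop l z))
    refine ⟨l + a, l + b, fun y hy => ?_⟩
    obtain ⟨y, rfl⟩ := (U.stateHomeo q).surjective y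
    rw [hconj, hconj]
    obtain ⟨hy₁, hy₂⟩ := agree_add_iff.1 hy
    have hzy : Agree l z y := (U.agree_applyFun_iff q).1 hy₁
    have hy : PrefixOf α y := PrefixOf.of_agree hz hzy
    have hfy : ∀ y, PrefixOf α y → PrefixOf α (f y) ∧
        Cantor.drop l (f y) = g (Cantor.drop l y) := by
      intro y hy
      have := hf.1 (Cantor.drop l y)
      rw [PrefixOf.appendInf_drop hy] at this
      rw [this]
      exact ⟨prefixOf_appendInf _ _, drop_appendInf _ _⟩
    have hs : ∀ y, PrefixOf α y → U.stateAt q y l = s := fun y hy =>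
      U.stateAt_congr q (PrefixOf.agree hy hz)
    have hd : ∀ y, PrefixOf α y → Cantor.drop l (U.stateHomeo q y) =
        U.applyFun s (Cantor.drop l y) := fun y hy => by
      rw [← hs y hy]
      exact U.drop_applyFun q y l
    have hds : ∀ y, PrefixOf α y →
        (U.stateHomeo s * g * (U.stateHomeo s)⁻¹) (U.applyFun s (Cantor.drop l y)) =
          Cantor.drop l (U.stateHomeo q (f y)) := fun y hy => by
      rw [hd _ (hfy y hy).1, (hfy y hy).2]
      exact congrArg (fun y => U.applyFun s (g y)) (U.inv_applyFun_applyFun s _)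
    rw [hd z hz, hd y hy] at hy₂
    obtain ⟨h₁, h₂⟩ := h _ hy₂
    rw [hds z hz, hds y hy] at h₁
    rw [hds y hy, ← hd y hy, drop_drop, drop_drop] at h₂
    exact ⟨agree_add_iff.2 ⟨(U.agree_applyFun_iff q).2
      (PrefixOf.agree (hfy z hz).1 (hfy y hy).1), h₁⟩, h₂⟩
  · refine ⟨α.length, α.length, fun y hy => ?_⟩
    obtain ⟨y, rfl⟩ := (U.stateHomeo q).surjective y
    have hy' : ¬ PrefixOf α y := fun hy' =>
      hz (PrefixOf.of_agree hy' ((U.agree_applyFun_iff q).1 hy).symm)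
    rw [hconj, hconj, hf.2 z hz, hf.2 y hy']
    exact ⟨hy, rfl⟩

lemma exists_applyFun_appendInf (hn : 0 < n) (q : U.Q) (w : List (Fin n)) :
    ∃ (w' : List (Fin n)) (s : U.Q), ∀ χ,
      U.applyFun q (appendInf w' χ) = appendInf w (U.applyFun s χ) := by
  set z := U.inv.applyFun q (appendInf w fun _ => ⟨0, hn⟩) with hz
  have hw : PrefixOf w (U.applyFun q z) := by
    rw [hz, applyFun_inv_applyFun]
    exact prefixOf_appendInf _ _
  refine ⟨takeW z w.length, U.stateAt q z w.length, fun χ => ?_⟩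
  have hzχ : Agree w.length z (appendInf (takeW z w.length) χ) :=
    prefixOf_takeW_iff.1 (prefixOf_appendInf _ _)
  rw [← PrefixOf.appendInf_drop (PrefixOf.of_agree hw ((U.agree_applyFun_iff q).2 hzχ)),
    drop_applyFun, ← U.stateAt_congr q hzχ]
  have := drop_appendInf (takeW z w.length) χ
  rw [length_takeW] at this
  rw [this]

lemma inv_mul_mul_mem_NekG (hn : 0 < n) (q : U.Q) {v : Cantor n ≃ₜ Cantor n}
    (hv : v ∈ Vn n) :
    (U.stateHomeo q)⁻¹ * v * U.stateHomeo q ∈ NekG n (autG (U.sprod U.inv)) := by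
  obtain ⟨m, α, β, hα, hβ, h⟩ := hv
  choose w s hw using fun γ => exists_applyFun_appendInf hn q (γ : List (Fin n))
  have hpre : ∀ γ χ, PrefixOf (w γ) χ ↔ PrefixOf γ (U.stateHomeo q χ) := by
    intro γ χ
    rw [prefixOf_iff_exists, prefixOf_iff_exists,
      (U.stateHomeo (s γ)).surjective.exists (p := fun ξ => appendInf γ ξ = _)]
    refine exists_congr fun ξ => ?_
    rw [← (U.stateHomeo q).injective.eq_iff]
    exact Eq.congr_left (hw γ ξ)
  have hanti : ∀ γ : Fin m → List (Fin n), AntichainFam γ → AntichainFam fun i => w (γ i) :=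
    fun γ hγ => antichainFam_of_apply (e := (U.stateHomeo q).symm.toEquiv) hγ fun i χ => by
      simp [hpre]
  refine mem_NekG_of_antichainFam (hanti α hα) (hanti β hβ)
    (g := fun i => (U.stateHomeo (s (β i)))⁻¹ * U.stateHomeo (s (α i)))
    (fun i => U.inv_mul_stateHomeo_mem_autG _ _) fun i χ => ?_
  change (U.stateHomeo q).symm (v (U.applyFun q _)) = _
  rw [hw, h, Homeomorph.symm_apply_eq]
  refine Eq.trans ?_ (hw _ _).symm
  exact congrArg _ (U.applyFun_inv_applyFun _ _).symm

end SyncTransducer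

/-- Theorem 5.1. Let `U` be a minimal, synchronous, synchronizing
invertible transducer with inverse `S = U.inv`, and let `q0` be a state of `U`.  Then
`Vₙ^{U_{q0}⁻¹} = Vₙ(𝒢(US))`, where `Vₙ^{U_{q0}⁻¹} = U_{q0} Vₙ U_{q0}⁻¹` and
`Vₙ(𝒢(US))` is the Nekrashevych group generated by `Vₙ` and the homeomorphisms
`[α]_g` for `g ∈ 𝒢(US)`. -/
theorem conjugate_overgroup_eq_Nekrashevych_group
    {n : ℕ} (hn : 2 ≤ n) (U : SyncTransducer n) (hmin : U.Minimal)
    (hsync : U.Synchronizing) (q0 : U.Q)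
    (h : Cantor n ≃ₜ Cantor n) (hh : ⇑h = U.applyFun q0) :
    paperConj h.symm '' Vn n =
      ↑(NekG n (SyncTransducer.autG (U.sprod U.inv))) := by
  have hn' : 0 < n := by omega
  obtain rfl : h = U.stateHomeo q0 := DFunLike.coe_injective hh
  apply Set.Subset.antisymm
  · rintro _ ⟨v, hv, rfl⟩
    exact SyncTransducer.inv_mul_mul_mem_NekG hn' q0 hv
  · suffices NekG n (SyncTransducer.autG (U.sprod U.inv)) ≤
        (Cantor.prefixExchange n).comap (MulAut.conj (U.stateHomeo q0)).toMonoidHom by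
      intro f hf
      refine ⟨U.stateHomeo q0 * f * (U.stateHomeo q0)⁻¹, ?_, ?_⟩
      · rw [← Cantor.coe_prefixExchange hn']
        exact this hf
      · change (U.stateHomeo q0)⁻¹ * (U.stateHomeo q0 * f * (U.stateHomeo q0)⁻¹) *
          U.stateHomeo q0 = f
        group
    refine (Subgroup.closure_le _).2 (Set.union_subset ?_ ?_)
    · rw [← Cantor.coe_prefixExchange hn']
      exact fun v hv => hsync.conj_mem_prefixExchange q0 hv
    · rintro f ⟨α, g, hg, hf⟩
      exact hsync.conj_mem_prefixExchange_of_isRestrTo hg hf q0
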